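/- Let S ≤ S' be additive submonoids of ℕ with the pair (S, S') equi-gcd and F(S'/S) = {w}. The following are equivalent: (1) S is almost symmetric in S', i.e. there is exactly one maximal element of PF(S'/S); (2) for every t ∈ PF(S'/S) with t ≠ w there exists t' ∈ PF(S'/S) with t' ≠ w and t + t' = w (equivalently, writing PF(S'/S) \ {w} = {t₁ < ⋯ < t_{n-1}}, one has tᵢ + t_{n-i} = w for all i); (3) Nat.card (G(S'/S)) = Nat.card (N(S'/S)) + Nat.card (PF(S'/S)) - 1. -/

import Mathlib

/-- The pair `(S, S')` is equi-gcd: a natural number divides every element of `S`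
iff it divides every element of `S'`. -/
def EquiGcd (S S' : AddSubmonoid ℕ) : Prop :=
  ∀ d : ℕ, (∀ x ∈ S, d ∣ x) ↔ (∀ x ∈ S', d ∣ x)

/-- The gap set `G(S'/S) = S' \ S`. -/
def gapSet (S S' : AddSubmonoid ℕ) : Set ℕ := (S' : Set ℕ) \ (S : Set ℕ)

/-- The sporadic set `N(S'/S)` of elements of `S` not in the conductor. -/
def sporadicSet (S S' : AddSubmonoid ℕ) : Set ℕ :=
  {a : ℕ | a ∈ S ∧ ∃ t ∈ S', a + t ∉ S}

/-- The pseudo-Frobenius set `PF(S'/S)`. -/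
def pseudoFrobSet (S S' : AddSubmonoid ℕ) : Set ℕ :=
  {w : ℕ | w ∈ S' ∧ w ∉ S ∧ ∀ s ∈ S, s ≠ 0 → w + s ∈ S}

/-- The Frobenius set `F(S'/S)`. -/
def frobSet (S S' : AddSubmonoid ℕ) : Set ℕ :=
  {w : ℕ | w ∈ S' ∧ w ∉ S ∧ ∀ t ∈ S', t ≠ 0 → w + t ∈ S}

/-- `S` is irreducible in `S'`. -/
def IrreducibleIn (S S' : AddSubmonoid ℕ) : Prop :=
  ∀ T₁ T₂ : AddSubmonoid ℕ, S ≤ T₁ → T₁ ≤ S' → S ≤ T₂ → T₂ ≤ S' →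
    T₁ ⊓ T₂ = S → T₁ = S ∨ T₂ = S

/-- The fundamental gap set `FG(S'/S)`. -/
def fundGapSet (S S' : AddSubmonoid ℕ) : Set ℕ :=
  {t : ℕ | t ∈ S' ∧ t ∉ S ∧ 2 * t ∈ S ∧ 3 * t ∈ S}

/-- If `(S, S')` is equi-gcd, then `S' \ S` is finite. -/
theorem EquiGcd.finite_gapSet {S S' : AddSubmonoid ℕ} (h : EquiGcd S S') :
    (gapSet S S').Finite := by
  obtain ⟨n, hn⟩ := Nat.exists_mem_closure_of_ge (S : Set ℕ)
  rw [AddSubmonoid.closure_eq] at hn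
  refine (Set.finite_lt_nat n).subset fun m hm ↦ ?_
  by_contra hge
  exact hm.2 <| hn m (not_lt.mp hge) <|
    (h _).mp (fun x hx ↦ Nat.setGcd_dvd_of_mem hx) m hm.1

theorem pseudoFrobSet_subset_gapSet (S S' : AddSubmonoid ℕ) :
    pseudoFrobSet S S' ⊆ gapSet S S' := fun _ h ↦ ⟨h.1, h.2.1⟩

theorem ne_zero_of_mem_gapSet {S S' : AddSubmonoid ℕ} {g : ℕ} (hg : g ∈ gapSet S S') :
    g ≠ 0 := by
  rintro rfl
  exact hg.2 S.zero_mem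

/-- Among the translates of a gap by elements of `A` that are still gaps, there is a largest. -/
theorem exists_add_mem_gapSet_maximal {S S' A : AddSubmonoid ℕ} (hfin : (gapSet S S').Finite)
    (hA : A ≤ S') {g : ℕ} (hg : g ∈ gapSet S S') :
    ∃ u ∈ A, g + u ∈ gapSet S S' ∧ ∀ t ∈ A, t ≠ 0 → g + u + t ∈ S := by
  obtain ⟨x, ⟨hx, u, hu, rfl⟩, hmax⟩ := Set.exists_max_image
    {x | x ∈ gapSet S S' ∧ ∃ u ∈ A, g + u = x} id (hfin.subset fun _ h ↦ h.1)
    ⟨g, hg, 0, A.zero_mem, add_zero g⟩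
  refine ⟨u, hu, hx, fun t ht ht0 ↦ ?_⟩
  by_contra hS
  have := hmax (g + u + t) ⟨⟨S'.add_mem hx.1 (hA ht), hS⟩, u + t, A.add_mem hu ht, by ring⟩
  simp only [id] at this
  omega

/-- Every gap can be moved into the pseudo-Frobenius set by adding an element of `S`. -/
theorem exists_add_mem_pseudoFrobSet {S S' : AddSubmonoid ℕ} (hfin : (gapSet S S').Finite)
    (hSS' : S ≤ S') {g : ℕ} (hg : g ∈ gapSet S S') :
    ∃ s ∈ S, g + s ∈ pseudoFrobSet S S' := by
  obtain ⟨s, hs, hgs, hmax⟩ := exists_add_mem_gapSet_maximal hfin hSS' hg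
  exact ⟨s, hs, hgs.1, hgs.2, hmax⟩

/-- If `w` is the only Frobenius element, every gap is complemented to `w` by an element of
`S'`. -/
theorem exists_add_eq_of_frobSet_eq_singleton {S S' : AddSubmonoid ℕ}
    (hfin : (gapSet S S').Finite) {w : ℕ} (hw : frobSet S S' = {w}) {g : ℕ}
    (hg : g ∈ gapSet S S') : ∃ u ∈ S', g + u = w := by
  obtain ⟨u, hu, hgu, hmax⟩ := exists_add_mem_gapSet_maximal hfin le_rfl hg
  have : g + u ∈ frobSet S S' := ⟨hgu.1, hgu.2, hmax⟩
  exact ⟨u, hu, by simpa [hw] using this⟩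

theorem frobSet_subset_pseudoFrobSet {S S' : AddSubmonoid ℕ} (hSS' : S ≤ S') :
    frobSet S S' ⊆ pseudoFrobSet S S' :=
  fun _ h ↦ ⟨h.1, h.2.1, fun s hs ↦ h.2.2 s (hSS' hs)⟩

/-- If a sum of three pseudo-Frobenius elements lies outside `S`, so does the sum of any two,
and this sum is pseudo-Frobenius. -/
theorem add_mem_pseudoFrobSet {S S' : AddSubmonoid ℕ} {t u v : ℕ}
    (ht : t ∈ pseudoFrobSet S S') (hu : u ∈ pseudoFrobSet S S') (hv : v ∈ pseudoFrobSet S S')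
    (h : t + u + v ∉ S) : u + v ∈ pseudoFrobSet S S' := by
  have hv0 := ne_zero_of_mem_gapSet (pseudoFrobSet_subset_gapSet S S' hv)
  refine ⟨S'.add_mem hu.1 hv.1, fun hS ↦ h ?_, fun s hs hs0 ↦ ?_⟩
  · rw [add_assoc]
    exact ht.2.2 _ hS (by omega)
  · rw [add_assoc]
    exact hu.2.2 _ (hv.2.2 s hs hs0) (by omega)

/-- A pseudo-Frobenius element which is not a maximal one can be completed to a maximal one. -/
theorem exists_add_mem_pseudoFrobSet_maximal {S S' : AddSubmonoid ℕ}
    (hfin : (gapSet S S').Finite) {t v : ℕ} (ht : t ∈ pseudoFrobSet S S')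
    (hv : v ∈ pseudoFrobSet S S') (htv : t + v ∈ pseudoFrobSet S S') :
    ∃ u ∈ pseudoFrobSet S S', t + u ∈ pseudoFrobSet S S' ∧
      ∀ v' ∈ pseudoFrobSet S S', t + u + v' ∉ pseudoFrobSet S S' := by
  obtain ⟨u, ⟨hu, htu⟩, hmax⟩ := Set.exists_max_image
    {u | u ∈ pseudoFrobSet S S' ∧ t + u ∈ pseudoFrobSet S S'} id
    (hfin.subset fun _ h ↦ pseudoFrobSet_subset_gapSet S S' h.1) ⟨v, hv, htv⟩
  refine ⟨u, hu, htu, fun v' hv' h ↦ ?_⟩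
  have := hmax (u + v') ⟨add_mem_pseudoFrobSet ht hu hv' h.2.1, by rwa [← add_assoc]⟩
  have hv0 := ne_zero_of_mem_gapSet (pseudoFrobSet_subset_gapSet S S' hv')
  simp only [id] at this
  omega

/-- The gaps `g` whose complement `w - g` is again a gap. -/
def selfDualGapSet (S S' : AddSubmonoid ℕ) (w : ℕ) : Set ℕ :=
  {g | g ∈ gapSet S S' ∧ ∃ g' ∈ gapSet S S', g + g' = w}

theorem pseudoFrobSet_diff_subset_selfDualGapSet {S S' : AddSubmonoid ℕ}
    (hfin : (gapSet S S').Finite) {w : ℕ} (hw : frobSet S S' = {w}) :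
    pseudoFrobSet S S' \ {w} ⊆ selfDualGapSet S S' w := by
  rintro t ⟨ht, htw⟩
  have hwF : w ∈ frobSet S S' := by simp [hw]
  have htG := pseudoFrobSet_subset_gapSet S S' ht
  obtain ⟨u, hu, htu⟩ := exists_add_eq_of_frobSet_eq_singleton hfin hw htG
  refine ⟨htG, u, ⟨hu, fun huS ↦ hwF.2.1 ?_⟩, htu⟩
  rw [← htu]
  refine ht.2.2 u huS ?_
  rintro rfl
  exact htw htu

/-- The gaps whose complement to `w` lies in `S` are in bijection with the sporadic elements. -/
theorem ncard_gapSet_eq {S S' : AddSubmonoid ℕ} (hfin : (gapSet S S').Finite) (hSS' : S ≤ S')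
    {w : ℕ} (hw : frobSet S S' = {w}) :
    (gapSet S S').ncard = (sporadicSet S S').ncard + (selfDualGapSet S S' w).ncard := by
  have hwF : w ∈ frobSet S S' := by simp [hw]
  have key : ∀ a ∈ sporadicSet S S', ∃ g ∈ S', g + a = w := by
    rintro a ⟨ha, t, ht, hat⟩
    obtain ⟨u, hu, h⟩ := exists_add_eq_of_frobSet_eq_singleton hfin hw
      (g := a + t) ⟨S'.add_mem (hSS' ha) ht, hat⟩
    exact ⟨t + u, S'.add_mem ht hu, by omega⟩
  have himage : (fun a ↦ w - a) '' sporadicSet S S' = gapSet S S' \ selfDualGapSet S S' w := by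
    ext g
    constructor
    · rintro ⟨a, ha, rfl⟩
      obtain ⟨g, hg, hga⟩ := key a ha
      obtain rfl : g = w - a := by omega
      refine ⟨⟨hg, fun hS ↦ hwF.2.1 (hga ▸ S.add_mem hS ha.1)⟩, ?_⟩
      rintro ⟨-, g', hg', h⟩
      dsimp only at h
      obtain rfl : g' = a := by omega
      exact hg'.2 ha.1
    · rintro ⟨hg, hgL⟩
      obtain ⟨u, hu, h⟩ := exists_add_eq_of_frobSet_eq_singleton hfin hw hg
      have huS : u ∈ S := by
        by_contra huS
        exact hgL ⟨hg, u, ⟨hu, huS⟩, h⟩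
      refine ⟨u, ⟨huS, g, hg.1, ?_⟩, by dsimp only; omega⟩
      rw [add_comm, h]
      exact hwF.2.1
  have hinj : Set.InjOn (fun a ↦ w - a) (sporadicSet S S') := by
    intro a ha b hb hab
    obtain ⟨g, -, hga⟩ := key a ha
    obtain ⟨g', -, hgb⟩ := key b hb
    dsimp only at hab
    omega
  rw [← hinj.ncard_image, himage]
  exact (Set.ncard_sdiff_add_ncard_of_subset (fun _ h ↦ h.1) hfin).symm

/-- The pseudo-Frobenius elements are symmetric about `w` iff every gap whose complement to `w`
is a gap is pseudo-Frobenius. -/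
theorem pseudoFrobSet_symmetric_iff {S S' : AddSubmonoid ℕ} (hfin : (gapSet S S').Finite)
    (hSS' : S ≤ S') {w : ℕ} (hw : frobSet S S' = {w}) :
    (∀ t ∈ pseudoFrobSet S S', t ≠ w → ∃ t' ∈ pseudoFrobSet S S', t' ≠ w ∧ t + t' = w) ↔
      selfDualGapSet S S' w = pseudoFrobSet S S' \ {w} := by
  constructor
  · intro h
    refine Set.Subset.antisymm ?_ (pseudoFrobSet_diff_subset_selfDualGapSet hfin hw)
    rintro g ⟨hg, g', hg', hgg'⟩
    have hg0 := ne_zero_of_mem_gapSet hg'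
    obtain ⟨s, hs, hgs⟩ := exists_add_mem_pseudoFrobSet hfin hSS' hg
    by_cases hgsw : g + s = w
    · obtain rfl : s = g' := by omega
      exact absurd hs hg'.2
    · obtain ⟨t', ht', -, ht'w⟩ := h _ hgs hgsw
      have hs0 : s = 0 := by
        by_contra hs0
        obtain rfl : g' = t' + s := by omega
        exact hg'.2 (ht'.2.2 s hs hs0)
      subst hs0
      exact ⟨hgs, hgsw⟩
  · intro h t ht htw
    obtain ⟨hg, g', hg', hgg'⟩ : t ∈ selfDualGapSet S S' w := h ▸ ⟨ht, htw⟩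
    have hmem : g' ∈ pseudoFrobSet S S' \ {w} := h ▸ ⟨hg', t, hg, by omega⟩
    exact ⟨g', hmem.1, hmem.2, hgg'⟩

theorem almost_symmetric_tfae (S S' : AddSubmonoid ℕ) (hSS' : S ≤ S')
    (hgcd : EquiGcd S S') (w : ℕ) (hw : frobSet S S' = {w}) :
    [(∃! v : ℕ, v ∈ pseudoFrobSet S S' ∧
        ∀ v' ∈ pseudoFrobSet S S', v + v' ∉ pseudoFrobSet S S'),
     (∀ t ∈ pseudoFrobSet S S', t ≠ w →
        ∃ t' ∈ pseudoFrobSet S S', t' ≠ w ∧ t + t' = w),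
     Nat.card (gapSet S S') =
       Nat.card (sporadicSet S S') + Nat.card (pseudoFrobSet S S') - 1].TFAE := by
  have hfin := hgcd.finite_gapSet
  have hwF : w ∈ frobSet S S' := by simp [hw]
  have hwPF := frobSet_subset_pseudoFrobSet hSS' hwF
  have hwmax : ∀ v' ∈ pseudoFrobSet S S', w + v' ∉ pseudoFrobSet S S' := fun v' hv' h ↦
    h.2.1 (hwF.2.2 v' hv'.1 (ne_zero_of_mem_gapSet (pseudoFrobSet_subset_gapSet S S' hv')))
  tfae_have 1 → 2 := by
    intro h t ht htw
    have hnot : ¬ ∀ v' ∈ pseudoFrobSet S S', t + v' ∉ pseudoFrobSet S S' :=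
      fun hmax ↦ htw (h.unique ⟨ht, hmax⟩ ⟨hwPF, hwmax⟩)
    push Not at hnot
    obtain ⟨v, hv, htv⟩ := hnot
    obtain ⟨u, hu, htu, hmax⟩ := exists_add_mem_pseudoFrobSet_maximal hfin ht hv htv
    have htuw := h.unique ⟨htu, hmax⟩ ⟨hwPF, hwmax⟩
    have ht0 := ne_zero_of_mem_gapSet (pseudoFrobSet_subset_gapSet S S' ht)
    exact ⟨u, hu, by omega, htuw⟩
  tfae_have 2 → 1 := by
    intro h
    refine ⟨w, ⟨hwPF, hwmax⟩, fun v ⟨hv, hvmax⟩ ↦ ?_⟩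
    by_contra hvw
    obtain ⟨t', ht', -, hsum⟩ := h v hv hvw
    exact hvmax t' ht' (hsum ▸ hwPF)
  tfae_have 2 ↔ 3 := by
    rw [pseudoFrobSet_symmetric_iff hfin hSS' hw]
    simp only [Nat.card_coe_set_eq]
    have hPF := Set.ncard_sdiff_singleton_add_one hwPF
      (hfin.subset (pseudoFrobSet_subset_gapSet S S'))
    rw [ncard_gapSet_eq hfin hSS' hw]
    constructor
    · intro h
      rw [h]
      omega
    · intro h
      exact (Set.eq_of_subset_of_ncard_le (pseudoFrobSet_diff_subset_selfDualGapSet hfin hw)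
        (by omega) (hfin.subset fun _ h ↦ h.1)).symm
  tfae_finish
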